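/- arXiv:1509.08484 — 2 statements merged into one kernel-verified Lean document; each statement's English description precedes it below -/
import Mathlib

section
/- Let V ⊆ M^k be a definable open set. Every correspondence f: V ⇉ M^l is continuous on a definable open dense subset of V, and hence is continuous almost everywhere on V. -/
/-! Common framework: dp-minimal structures with a definable uniform structure,
following "Dp-minimal structures equipped with definable uniformities". -/

namespace DpTame

open FirstOrder Set Cardinal

universe u

variable (L : FirstOrder.Language.{u, u}) (M : Type u) [L.Structure M]

/-- `A ⊆ M^α` is definable with parameters from `C ⊆ M`. -/
def DefSetP (C : Set M) {α : Type} (A : Set (α → M)) : Prop :=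
  C.Definable L A

/-- `A ⊆ M^α` is definable (with parameters from `M`). -/
def DefSet {α : Type} (A : Set (α → M)) : Prop :=
  (Set.univ : Set M).Definable L A

/-- A subset of `M` is definable (with parameters). -/
def DefSet1 (A : Set M) : Prop :=
  DefSet L M {v : Fin 1 → M | v 0 ∈ A}

/-- A definable relation between two tuple sorts, with parameters from `C`. -/
def DefRelP (C : Set M) {k l : ℕ} (G : Set ((Fin k → M) × (Fin l → M))) : Prop :=
  DefSetP L M C {v : (Fin k ⊕ Fin l) → M | (v ∘ Sum.inl, v ∘ Sum.inr) ∈ G}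

/-- A definable relation between two tuple sorts, with parameters from `M`. -/
def DefRel {k l : ℕ} (G : Set ((Fin k → M) × (Fin l → M))) : Prop :=
  DefRelP L M Set.univ G

/-- A definable subset of `M × M`. -/
def DefRel1 (G : Set (M × M)) : Prop :=
  DefSet L M {v : Fin 2 → M | (v 0, v 1) ∈ G}

/-- Model-theoretic algebraic closure of a parameter set `C ⊆ M`:
`a` lies in a finite `C`-definable set. -/
def aclOf (C : Set M) : Set M :=
  {a | ∃ S : Set (Fin 1 → M), C.Definable L S ∧ S.Finite ∧ (fun _ => a) ∈ S}

/-- The acl-dimension of a tuple over `C`: the minimal size of a subtuple over which (together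
with `C`) the whole tuple is algebraic. -/
noncomputable def aclDimTuple (C : Set M) {k : ℕ} (a : Fin k → M) : ℕ :=
  sInf {l | ∃ s : Finset (Fin k), s.card = l ∧ ∀ i, a i ∈ aclOf L M (C ∪ (a '' ↑s))}

open Classical in
/-- The acl-dimension of a set `A ⊆ M^k` defined over `C` (with `⊥` for the empty set). -/
noncomputable def aclDim (C : Set M) {k : ℕ} (A : Set (Fin k → M)) : WithBot ℕ :=
  if A = ∅ then ⊥ else ↑(sSup {l | ∃ a ∈ A, aclDimTuple L M C a = l})

/-- `A ⊆ M^k` has dp-rank greater than `n`: there are (definable-with-parameters) formulas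
`φ_i(x,y)` for `i ≤ n` (coded as definable subsets of `M^k × M`) and infinite sets `B i ⊆ M`
such that every choice from `∏ B i` is coded by an element of `A`. -/
def DpRankGt {k : ℕ} (A : Set (Fin k → M)) (n : ℕ) : Prop :=
  ∃ (Φ : Fin (n + 1) → Set ((Fin k ⊕ Fin 1) → M)) (B : Fin (n + 1) → Set M),
    (∀ i, DefSet L M (Φ i)) ∧ (∀ i, (B i).Infinite) ∧
    ∀ b : Fin (n + 1) → M, (∀ i, b i ∈ B i) →
      ∃ a ∈ A, ∀ i, ∀ y ∈ B i, (Sum.elim a (fun _ => y) ∈ Φ i ↔ y = b i)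

open Classical in
/-- The dp-rank of a definable set, with `⊥` for the empty set. -/
noncomputable def dpRank {k : ℕ} (A : Set (Fin k → M)) : WithBot ℕ :=
  if A = ∅ then ⊥ else ↑(sSup {m : ℕ | ∃ n, m = n + 1 ∧ DpRankGt L M A n})

/-- Dp-minimality (with respect to the home sort `M`): `M` does not have dp-rank greater
than one. -/
def DpMinimal : Prop :=
  ¬ DpRankGt L M (Set.univ : Set (Fin 1 → M)) 1

/-- `M` is NIP: no definable relation has the independence property. -/
def IsNIP : Prop :=
  ∀ (n m : ℕ) (Φ : Set ((Fin n ⊕ Fin m) → M)), DefSet L M Φ →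
    ¬ ∃ (a : ℕ → Fin n → M) (b : Finset ℕ → Fin m → M),
        ∀ (i : ℕ) (s : Finset ℕ), (Sum.elim (a i) (b s) ∈ Φ ↔ i ∈ s)

/-- Every finitely satisfiable collection of formulas in one variable over `C` is realized. -/
def RealizesTypesOver (C : Set M) : Prop :=
  ∀ p : Set ((L[[C]]).Formula (Fin 1)),
    (∀ s : Finset ((L[[C]]).Formula (Fin 1)), ↑s ⊆ p →
      ∃ a : M, ∀ φ ∈ s, φ.Realize (fun _ => a)) →
    ∃ a : M, ∀ φ ∈ p, φ.Realize (fun _ => a)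

/-- `M` is `|L|⁺`-saturated. -/
def IsLPlusSaturated : Prop :=
  ∀ C : Set M, #C ≤ L.card + ℵ₀ → RealizesTypesOver L M C

/-- Two tuples have the same type over `C`. -/
def SameTypeOver (C : Set M) {n : ℕ} (a b : Fin n → M) : Prop :=
  ∀ φ : (L[[C]]).Formula (Fin n), φ.Realize a ↔ φ.Realize b

/-- A sequence indexed by `ℕ` is indiscernible over `C`. -/
def IndiscernibleOver (C : Set M) (I : ℕ → M) : Prop :=
  ∀ (n : ℕ) (f g : Fin n → ℕ), StrictMono f → StrictMono g →
    SameTypeOver L M C (I ∘ f) (I ∘ g)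

/-- The sequences `I l` are mutually indiscernible over `C`: each is indiscernible over `C`
together with all of the other sequences. -/
def MutuallyIndiscernibleOver (C : Set M) {k : ℕ} (I : Fin k → ℕ → M) : Prop :=
  ∀ l : Fin k,
    IndiscernibleOver L M (C ∪ ⋃ m ∈ ({m : Fin k | m ≠ l} : Set (Fin k)), Set.range (I m)) (I l)

/-- A correspondence with domain `E ⊆ M^k`, values in `M^l`, definable over `C`: a definable
graph all of whose fibers over points of `E` are finite and nonempty. -/
def IsCorrP (C : Set M) {k l : ℕ} (E : Set (Fin k → M))
    (G : Set ((Fin k → M) × (Fin l → M))) : Prop :=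
  DefRelP L M C G ∧ (∀ p ∈ G, p.1 ∈ E) ∧
    ∀ x ∈ E, {y | (x, y) ∈ G}.Nonempty ∧ {y | (x, y) ∈ G}.Finite

/-- A correspondence, definable with arbitrary parameters. -/
def IsCorr {k l : ℕ} (E : Set (Fin k → M)) (G : Set ((Fin k → M) × (Fin l → M))) : Prop :=
  IsCorrP L M Set.univ E G

/-- An `m`-correspondence: every fiber has exactly `m` elements. -/
def IsMCorrP (C : Set M) {k l : ℕ} (E : Set (Fin k → M))
    (G : Set ((Fin k → M) × (Fin l → M))) (m : ℕ) : Prop :=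
  IsCorrP L M C E G ∧ ∀ x ∈ E, {y | (x, y) ∈ G}.ncard = m

/-- An `m`-correspondence definable with arbitrary parameters. -/
def IsMCorr {k l : ℕ} (E : Set (Fin k → M)) (G : Set ((Fin k → M) × (Fin l → M)))
    (m : ℕ) : Prop :=
  IsMCorrP L M Set.univ E G m

/-- A definable uniform structure on `M`: a definable basis of entourages
`{φ(M², c̄) : c̄ ∈ dom}` satisfying the axioms for a basis of a (Hausdorff) uniformity. -/
structure DefUniformBasis where
  n : ℕ
  dom : Set (Fin n → M)
  dom_nonempty : dom.Nonempty
  dom_def : DefSet L M dom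
  phi : Set ((Fin 2 ⊕ Fin n) → M)
  phi_def : DefSet L M phi
  symm : ∀ c ∈ dom, ∀ x y : M, Sum.elim ![x, y] c ∈ phi → Sum.elim ![y, x] c ∈ phi
  inter_eq_diag : ∀ x y : M, (∀ c ∈ dom, Sum.elim ![x, y] c ∈ phi) ↔ x = y
  directed : ∀ c ∈ dom, ∀ d ∈ dom, ∃ e ∈ dom, ∀ x y : M,
    Sum.elim ![x, y] e ∈ phi → Sum.elim ![x, y] c ∈ phi ∧ Sum.elim ![x, y] d ∈ phi
  comp : ∀ c ∈ dom, ∃ d ∈ dom, ∀ x y z : M,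
    Sum.elim ![x, y] d ∈ phi → Sum.elim ![y, z] d ∈ phi → Sum.elim ![x, z] c ∈ phi

namespace DefUniformBasis

variable {L M} (U : DefUniformBasis L M)

/-- The entourage with parameter `c`. -/
def ent (c : Fin U.n → M) : Set (M × M) :=
  {p | Sum.elim ![p.1, p.2] c ∈ U.phi}

/-- The ball of radius `c` around `x ∈ M`. -/
def ball (c : Fin U.n → M) (x : M) : Set M :=
  {y | (x, y) ∈ U.ent c}

/-- The ball of radius `c` around `x ∈ M^k` (product uniformity). -/
def ballk {k : ℕ} (c : Fin U.n → M) (x : Fin k → M) : Set (Fin k → M) :=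
  {y | ∀ i, (x i, y i) ∈ U.ent c}

/-- Openness in `M` for the topology induced by the uniform structure. -/
def IsOpen1 (A : Set M) : Prop :=
  ∀ x ∈ A, ∃ c ∈ U.dom, U.ball c x ⊆ A

/-- Interior in `M`. -/
def interior1 (A : Set M) : Set M :=
  {x | ∃ c ∈ U.dom, U.ball c x ⊆ A}

/-- Closure in `M`. -/
def closure1 (A : Set M) : Set M :=
  {x | ∀ c ∈ U.dom, (U.ball c x ∩ A).Nonempty}

/-- Openness in `M^k` for the product topology. -/
def IsOpenk {k : ℕ} (A : Set (Fin k → M)) : Prop :=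
  ∀ x ∈ A, ∃ c ∈ U.dom, U.ballk c x ⊆ A

/-- Interior in `M^k`. -/
def interiork {k : ℕ} (A : Set (Fin k → M)) : Set (Fin k → M) :=
  {x | ∃ c ∈ U.dom, U.ballk c x ⊆ A}

/-- Closure in `M^k`. -/
def closurek {k : ℕ} (A : Set (Fin k → M)) : Set (Fin k → M) :=
  {x | ∀ c ∈ U.dom, (U.ballk c x ∩ A).Nonempty}

/-- The frontier `∂A = cl(A) ∖ A`. -/
def frontierk {k : ℕ} (A : Set (Fin k → M)) : Set (Fin k → M) :=
  U.closurek A \ A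

/-- Closedness in `M^k`. -/
def IsClosedk {k : ℕ} (A : Set (Fin k → M)) : Prop :=
  U.closurek A ⊆ A

/-- `B` is dense in `A`. -/
def DenseIn {k : ℕ} (B A : Set (Fin k → M)) : Prop :=
  A ⊆ U.closurek B

/-- `A ⊆ M^k` is locally closed: every point of `A` has a (ball) neighborhood `W` such that
`A ∩ W` is closed in `W`. -/
def IsLocallyClosedk {k : ℕ} (A : Set (Fin k → M)) : Prop :=
  ∀ x ∈ A, ∃ c ∈ U.dom, U.ballk c x ∩ U.closurek (A ∩ U.ballk c x) ⊆ A

open Classical in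
/-- The naive topological dimension of `A ⊆ M^k`: the largest `l` such that some coordinate
projection of `A` to `M^l` has nonempty interior (`⊥` for the empty set). -/
noncomputable def topDim {k : ℕ} (A : Set (Fin k → M)) : WithBot ℕ :=
  if A = ∅ then ⊥ else
    ↑(sSup {l : ℕ | ∃ σ : Fin l → Fin k, Function.Injective σ ∧
        (U.interiork ((fun v => v ∘ σ) '' A)).Nonempty})

/-- Continuity of a correspondence with domain `E` and graph `G` at a point `x ∈ E`. -/
def CorrContAt {k l : ℕ} (E : Set (Fin k → M)) (G : Set ((Fin k → M) × (Fin l → M)))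
    (x : Fin k → M) : Prop :=
  ∀ c ∈ U.dom, ∃ d ∈ U.dom, ∀ x' ∈ E, x' ∈ U.ballk d x →
    (∀ y, (x, y) ∈ G → ∃ y', (x', y') ∈ G ∧ ∀ j, (y j, y' j) ∈ U.ent c) ∧
    (∀ y', (x', y') ∈ G → ∃ y, (x, y) ∈ G ∧ ∀ j, (y j, y' j) ∈ U.ent c)

/-- Continuity of a correspondence at every point of its domain. -/
def CorrContOn {k l : ℕ} (E : Set (Fin k → M)) (G : Set ((Fin k → M) × (Fin l → M))) : Prop :=
  ∀ x ∈ E, U.CorrContAt E G x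

/-- Continuity of a function `M^k → M^l` on a set `V` (relative topology). -/
def ContOn {k l : ℕ} (f : (Fin k → M) → (Fin l → M)) (V : Set (Fin k → M)) : Prop :=
  ∀ x ∈ V, ∀ c ∈ U.dom, ∃ d ∈ U.dom, ∀ y ∈ V, y ∈ U.ballk d x → f y ∈ U.ballk c (f x)

/-- `f` restricted to `V` is a homeomorphism onto its image. -/
def HomeoOnto {k l : ℕ} (f : (Fin k → M) → (Fin l → M)) (V : Set (Fin k → M)) : Prop :=
  Set.InjOn f V ∧ U.ContOn f V ∧
    ∀ x ∈ V, ∀ c ∈ U.dom, ∃ d ∈ U.dom, ∀ y ∈ V, f y ∈ U.ballk d (f x) → y ∈ U.ballk c x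

/-- Continuity of a function `M → M` on a set `V`. -/
def Cont1On (f : M → M) (V : Set M) : Prop :=
  ∀ x ∈ V, ∀ c ∈ U.dom, ∃ d ∈ U.dom, ∀ y ∈ V, y ∈ U.ball d x → f y ∈ U.ball c (f x)

/-- `f : M → M` restricted to `V` is a homeomorphism onto its image. -/
def Homeo1Onto (f : M → M) (V : Set M) : Prop :=
  Set.InjOn f V ∧ U.Cont1On f V ∧
    ∀ x ∈ V, ∀ c ∈ U.dom, ∃ d ∈ U.dom, ∀ y ∈ V, f y ∈ U.ball d (f x) → y ∈ U.ball c x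

end DefUniformBasis

/-- The standing assumptions of the paper: `M` is an infinite `|L|⁺`-saturated NIP dp-minimal
structure carrying a definable uniform structure whose topology has no isolated points and in
which every infinite definable subset of `M` has nonempty interior (Inf). -/
structure Setting extends DefUniformBasis L M where
  nonempty : Nonempty M
  saturated : IsLPlusSaturated L M
  nip : IsNIP L M
  dpMin : DpMinimal L M
  noIsolated : ∀ x : M, ∀ c ∈ toDefUniformBasis.dom, ∃ y, y ≠ x ∧
    y ∈ toDefUniformBasis.ball c x
  infInterior : ∀ A : Set M, DefSet1 L M A → A.Infinite →
    (toDefUniformBasis.interior1 A).Nonempty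

end DpTame

namespace DpTame

open FirstOrder Set Cardinal

universe u

variable {L : FirstOrder.Language.{u, u}} {M : Type u} [L.Structure M]

section DefinablePredicates

/-- A type identified with a finite power of `M`. -/
class TupleType (M : Type u) (X : Type u) where
  /-- The index set of the coordinates. -/
  Idx : Type
  /-- There are finitely many coordinates. -/
  finite_idx : Finite Idx
  /-- The coordinate map. -/
  coord : X ≃ (Idx → M)

instance (X : Type u) [TupleType M X] : Finite (TupleType.Idx M X) :=
  TupleType.finite_idx

instance TupleType.self (M : Type u) : TupleType M M where
  Idx := Unit
  finite_idx := inferInstance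
  coord := (Equiv.funUnique Unit M).symm

instance TupleType.prod (M X Y : Type u) [TupleType M X] [TupleType M Y] :
    TupleType M (X × Y) where
  Idx := Idx M X ⊕ Idx M Y
  finite_idx := inferInstance
  coord := (Equiv.prodCongr coord coord).trans (Equiv.sumArrowEquivProdArrow _ _ _).symm

instance TupleType.pi (M : Type u) (J : Type) [Finite J] (X : Type u) [TupleType M X] :
    TupleType M (J → X) where
  Idx := J × Idx M X
  finite_idx := inferInstance
  coord := (Equiv.piCongrRight fun _ => coord).trans (Equiv.curry J (Idx M X) M).symm

open TupleType

variable {X Y Z : Type u} [TupleType M X] [TupleType M Y] [TupleType M Z]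

variable (L M) in
/-- A predicate on tuples which is definable with parameters. -/
def DefPred (P : X → Prop) : Prop :=
  DefSet L M {v : Idx M X → M | P (coord.symm v)}

variable (L M) in
/-- A map between tuples whose coordinates are given by terms with parameters. -/
def TermMap (f : X → Y) : Prop :=
  ∀ j : Idx M Y, ∃ t : (L[[(Set.univ : Set M)]]).Term (Idx M X),
    ∀ x, (coord (f x) : Idx M Y → M) j = t.realize (coord x : Idx M X → M)

theorem DefPred.comp {P : Y → Prop} (hP : DefPred L M P) {f : X → Y} (hf : TermMap L M f) :
    DefPred L M fun x => P (f x) := by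
  obtain ⟨φ, hφ⟩ := hP
  choose t ht using hf
  refine ⟨φ.subst t, ?_⟩
  ext v
  have h1 := Set.ext_iff.1 hφ (coord (f (coord.symm v)))
  simp only [Set.mem_ofPred_eq, Equiv.symm_apply_apply] at h1 ⊢
  rw [h1, Language.Formula.Realize, Language.Formula.Realize,
    Language.BoundedFormula.realize_subst]
  have : (fun a => (t a).realize v) = (coord (f (coord.symm v)) : Idx M Y → M) := by
    funext j
    simp [ht]
  rw [this]

theorem DefPred.and {P Q : X → Prop} (hP : DefPred L M P) (hQ : DefPred L M Q) :
    DefPred L M fun x => P x ∧ Q x :=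
  Set.Definable.inter hP hQ

theorem DefPred.or {P Q : X → Prop} (hP : DefPred L M P) (hQ : DefPred L M Q) :
    DefPred L M fun x => P x ∨ Q x :=
  Set.Definable.union hP hQ

theorem DefPred.not {P : X → Prop} (hP : DefPred L M P) : DefPred L M fun x => ¬ P x :=
  Set.Definable.compl hP

theorem DefPred.imp {P Q : X → Prop} (hP : DefPred L M P) (hQ : DefPred L M Q) :
    DefPred L M fun x => P x → Q x := by
  simpa only [imp_iff_not_or] using hP.not.or hQ

theorem DefPred.const (p : Prop) : DefPred L M fun _ : X => p := by
  by_cases hp : p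
  · simpa only [DefPred, hp] using! Set.definable_univ
  · simpa only [DefPred, hp] using! Set.definable_empty

theorem DefPred.exists {P : X → Y → Prop} (hP : DefPred L M fun p : X × Y => P p.1 p.2) :
    DefPred L M fun x => ∃ y, P x y := by
  have h := Set.Definable.exists_of_finite hP
  refine (congrArg (DefSet L M) ?_).mp h
  ext v
  constructor
  · rintro ⟨u, hu⟩
    exact ⟨coord.symm u, hu⟩
  · rintro ⟨y, hy⟩
    refine ⟨coord y, ?_⟩
    change P (coord.symm v) (coord.symm (coord y))
    simpa using hy

theorem DefPred.forall {P : X → Y → Prop} (hP : DefPred L M fun p : X × Y => P p.1 p.2) :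
    DefPred L M fun x => ∀ y, P x y := by
  have := (DefPred.exists (P := fun x y => ¬ P x y) hP.not).not
  simpa only [not_exists, not_not] using this

theorem DefPred.forall_finite {J : Type*} [Finite J] {P : J → X → Prop}
    (hP : ∀ j, DefPred L M (P j)) : DefPred L M fun x => ∀ j, P j x := by
  have := Set.definable_iInter_of_finite hP
  refine (congrArg (DefSet L M) ?_).mp this
  ext v
  simp

theorem TermMap.id : TermMap L M fun x : X => x :=
  fun j => ⟨Language.Term.var j, fun _ => rfl⟩

theorem TermMap.const (y : Y) : TermMap L M fun _ : X => y :=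
  fun j => ⟨(L.con (⟨(coord y : Idx M Y → M) j, Set.mem_univ _⟩ : (Set.univ : Set M))).term,
    fun _ => by rw [Language.Term.realize_con]⟩

theorem TermMap.comp {g : Y → Z} {f : X → Y} (hg : TermMap L M g) (hf : TermMap L M f) :
    TermMap L M fun x => g (f x) := by
  choose t ht using hf
  intro j
  obtain ⟨s, hs⟩ := hg j
  refine ⟨s.subst t, fun x => ?_⟩
  rw [hs, Language.Term.realize_subst]
  congr 1
  funext i
  exact ht i x

theorem TermMap.fst {f : X → Y × Z} (hf : TermMap L M f) : TermMap L M fun x => (f x).1 :=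
  fun j => hf (Sum.inl j)

theorem TermMap.snd {f : X → Y × Z} (hf : TermMap L M f) : TermMap L M fun x => (f x).2 :=
  fun j => hf (Sum.inr j)

theorem TermMap.prodMk {f : X → Y} {g : X → Z} (hf : TermMap L M f) (hg : TermMap L M g) :
    TermMap L M fun x => (f x, g x)
  | Sum.inl j => hf j
  | Sum.inr j => hg j

theorem TermMap.pi {J : Type} [Finite J] {f : X → J → Y} (hf : ∀ j, TermMap L M fun x => f x j) :
    TermMap L M f :=
  fun i => hf i.1 i.2

theorem TermMap.apply {J : Type} [Finite J] {f : X → J → Y} (hf : TermMap L M f) (j : J) :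
    TermMap L M fun x => f x j :=
  fun i => hf (j, i)

theorem TermMap.cons {k : ℕ} {f : X → Y} {g : X → Fin k → Y} (hf : TermMap L M f)
    (hg : TermMap L M g) : TermMap L M fun x => (Fin.cons (f x) (g x) : Fin (k + 1) → Y) :=
  TermMap.pi (Fin.cases hf fun j => hg.apply j)

theorem DefPred.eq {f g : X → Y} (hf : TermMap L M f) (hg : TermMap L M g) :
    DefPred L M fun x => f x = g x := by
  have h : DefPred L M fun x => ∀ j, (coord (f x) : Idx M Y → M) j = coord (g x) j := by
    refine DefPred.forall_finite fun j => ?_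
    obtain ⟨s, hs⟩ := hf j
    obtain ⟨t, ht⟩ := hg j
    refine ⟨s.equal t, ?_⟩
    ext v
    simp [hs, ht, Language.Formula.realize_equal]
  refine (congrArg (DefPred L M) ?_).mp h
  funext x
  rw [← funext_iff, EmbeddingLike.apply_eq_iff_eq]

theorem defPred_of_defSet {J : Type} [Finite J] {A : Set (J → M)} (hA : DefSet L M A) :
    DefPred L M fun x => x ∈ A :=
  Set.Definable.preimage_comp (fun j : J => ((j, ()) : J × Unit)) hA

theorem DefPred.defSet {J : Type} [Finite J] {A : Set (J → M)}
    (hA : DefPred L M fun x => x ∈ A) : DefSet L M A :=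
  Set.Definable.preimage_comp (fun j : J × Unit => j.1) hA

end DefinablePredicates

section Saturation

open TupleType

variable {X Y : Type u} [TupleType M X] [TupleType M Y]

variable (L M) in
/-- Decreasing sequences of nonempty definable subsets of `X` have nonempty intersection. -/
def CountablySaturated (X : Type u) [TupleType M X] : Prop :=
  ∀ A : ℕ → X → Prop, (∀ n, DefPred L M (A n)) → (∀ n x, A (n + 1) x → A n x) →
    (∀ n, ∃ x, A n x) → ∃ x, ∀ n, A n x

theorem countablySaturated_self (h : IsLPlusSaturated L M) : CountablySaturated L M M := by
  intro A hA hmono hne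
  have hA' (n : ℕ) : ∃ C : Finset M, (C : Set M).Definable L {v : Fin 1 → M | A n (v 0)} := by
    have h1 : DefSet L M {v : Fin 1 → M | A n (v 0)} :=
      Set.Definable.preimage_comp (fun _ : Unit => (0 : Fin 1)) (hA n)
    obtain ⟨C, -, hC⟩ := Set.definable_iff_finitely_definable.1 h1
    exact ⟨C, hC⟩
  choose C hC using hA'
  have hC' (n : ℕ) : (⋃ n, (C n : Set M)).Definable L {v : Fin 1 → M | A n (v 0)} :=
    (hC n).mono (Set.subset_iUnion (fun n => (C n : Set M)) n)
  choose φ hφ using hC'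
  have hφ' (n : ℕ) (a : M) : (φ n).Realize (fun _ => a) ↔ A n a :=
    (Set.ext_iff.1 (hφ n) fun _ => a).symm
  have hcard : #(⋃ n, (C n : Set M) : Set M) ≤ L.card + ℵ₀ :=
    (Set.countable_iUnion fun n => (C n).countable_toSet).le_aleph0.trans le_add_self
  obtain ⟨a, ha⟩ := h _ hcard (Set.range φ) (by
    intro s hs
    have hanti : ∀ m n, m ≤ n → ∀ x, A n x → A m x := by
      intro m n hmn
      induction hmn with
      | refl => exact fun _ => id
      | step _ ih => exact fun x hx => ih x (hmono _ x hx)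
    have hN : ∃ N, ∀ ψ ∈ s, ∃ n ≤ N, φ n = ψ := by
      have hs' : ∀ ψ ∈ s, ∃ n, φ n = ψ := fun ψ hψ => hs hψ
      choose! g hg using hs'
      exact ⟨s.sup g, fun ψ hψ => ⟨g ψ, Finset.le_sup hψ, hg ψ hψ⟩⟩
    obtain ⟨N, hN⟩ := hN
    obtain ⟨a, ha⟩ := hne N
    refine ⟨a, fun ψ hψ => ?_⟩
    obtain ⟨n, hn, rfl⟩ := hN ψ hψ
    exact (hφ' n a).2 (hanti n N hn a ha))
  exact ⟨a, fun n => (hφ' n a).1 (ha _ ⟨n, rfl⟩)⟩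

theorem CountablySaturated.prod (hX : CountablySaturated L M X) (hY : CountablySaturated L M Y) :
    CountablySaturated L M (X × Y) := by
  intro A hA hmono hne
  obtain ⟨x, hx⟩ := hX (fun n x => ∃ y, A n (x, y)) (fun n => (hA n).exists)
    (fun n x ⟨y, hy⟩ => ⟨y, hmono n _ hy⟩) (fun n => by
      obtain ⟨p, hp⟩ := hne n
      exact ⟨p.1, p.2, hp⟩)
  obtain ⟨y, hy⟩ := hY (fun n y => A n (x, y))
    (fun n => (hA n).comp ((TermMap.const x).prodMk TermMap.id)) (fun n y => hmono n _) hx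
  exact ⟨(x, y), hy⟩

theorem CountablySaturated.pi (h : CountablySaturated L M X) (k : ℕ) :
    CountablySaturated L M (Fin k → X) := by
  induction k with
  | zero =>
    intro A _ _ hne
    refine ⟨Fin.elim0, fun n => ?_⟩
    obtain ⟨x, hx⟩ := hne n
    rwa [Subsingleton.elim Fin.elim0 x]
  | succ k ih =>
    intro A hA hmono hne
    obtain ⟨p, hp⟩ := h.prod ih (fun n p => A n (Fin.cons p.1 p.2))
      (fun n => (hA n).comp (TermMap.id.fst.cons TermMap.id.snd)) (fun n p => hmono n _)
      (fun n => by
        obtain ⟨x, hx⟩ := hne n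
        exact ⟨(x 0, Fin.tail x), by rwa [Fin.cons_self_tail]⟩)
    exact ⟨_, hp⟩

/-- Definable families of finite sets are uniformly bounded. -/
theorem CountablySaturated.exists_ncard_le (hX : CountablySaturated L M X) {G : X → Y → Prop}
    (hG : DefPred L M fun p : X × Y => G p.1 p.2) (hfin : ∀ x, {y | G x y}.Finite) :
    ∃ N, ∀ x, {y | G x y}.ncard ≤ N := by
  by_contra! hN
  obtain ⟨x, hx⟩ := hX
    (fun n x => ∃ g : Fin n → Y, (∀ i j, i ≠ j → g i ≠ g j) ∧ ∀ i, G x (g i))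
    (fun n => DefPred.exists
      ((DefPred.forall_finite fun i => DefPred.forall_finite fun j => (DefPred.const _).imp
        (DefPred.eq (TermMap.id.snd.apply i) (TermMap.id.snd.apply j)).not).and
      (DefPred.forall_finite fun i => hG.comp (TermMap.id.fst.prodMk (TermMap.id.snd.apply i)))))
    (fun n x ⟨g, hg, hg'⟩ => ⟨g ∘ Fin.castSucc,
      fun i j hij => hg _ _ fun h => hij (Fin.castSucc_injective n h), fun i => hg' _⟩)
    (fun n => by
      obtain ⟨x, hx⟩ := hN n
      obtain ⟨t, ht, hcard⟩ := Set.exists_subset_card_eq hx.le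
      have : t.Finite := (hfin x).subset ht
      have hcard' : this.toFinset.card = n := by rw [← hcard, Set.ncard_eq_toFinset_card t this]
      refine ⟨x, fun i => (this.toFinset.equivFinOfCardEq hcard').symm i,
        fun i j hij h => hij (Equiv.injective _ (Subtype.ext h)), fun i => ht ?_⟩
      exact this.mem_toFinset.1 ((this.toFinset.equivFinOfCardEq hcard').symm i).2)
  obtain ⟨g, hg, hg'⟩ := hx ({y | G x y}.ncard + 1)
  have hinj : Function.Injective g := fun i j hij => by
    by_contra hne
    exact hg i j hne hij
  have h1 : (Set.range g).ncard ≤ {y | G x y}.ncard :=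
    Set.ncard_le_ncard (by rintro _ ⟨i, rfl⟩; exact hg' i) (hfin x)
  rw [← Set.image_univ, Set.ncard_image_of_injective _ hinj, Set.ncard_univ, Nat.card_fin] at h1
  omega

end Saturation

namespace DefUniformBasis

variable (U : DefUniformBasis L M)

theorem ent_refl {c : Fin U.n → M} (hc : c ∈ U.dom) (x : M) : (x, x) ∈ U.ent c :=
  (U.inter_eq_diag x x).2 rfl c hc

theorem ent_symm {c : Fin U.n → M} (hc : c ∈ U.dom) {x y : M} (h : (x, y) ∈ U.ent c) :
    (y, x) ∈ U.ent c :=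
  U.symm c hc x y h

theorem exists_ent_subset_inter {c d : Fin U.n → M} (hc : c ∈ U.dom) (hd : d ∈ U.dom) :
    ∃ e ∈ U.dom, U.ent e ⊆ U.ent c ∧ U.ent e ⊆ U.ent d := by
  obtain ⟨e, he, h⟩ := U.directed c hc d hd
  exact ⟨e, he, fun p hp => (h p.1 p.2 hp).1, fun p hp => (h p.1 p.2 hp).2⟩

theorem exists_ent_comp {c : Fin U.n → M} (hc : c ∈ U.dom) :
    ∃ d ∈ U.dom, U.ent d ⊆ U.ent c ∧
      ∀ x y z, (x, y) ∈ U.ent d → (y, z) ∈ U.ent d → (x, z) ∈ U.ent c := by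
  obtain ⟨d, hd, h⟩ := U.comp c hc
  exact ⟨d, hd, fun p hp => h p.1 p.2 p.2 hp (U.ent_refl hd p.2), h⟩

variable {k : ℕ}

theorem mem_ballk_self {c : Fin U.n → M} (hc : c ∈ U.dom) (x : Fin k → M) : x ∈ U.ballk c x :=
  fun i => U.ent_refl hc (x i)

theorem ballk_mono {c d : Fin U.n → M} (h : U.ent d ⊆ U.ent c) (x : Fin k → M) :
    U.ballk d x ⊆ U.ballk c x :=
  fun _ hy i => h (hy i)

theorem cons_mem_ballk {c : Fin U.n → M} {a b : M} {x y : Fin k → M} :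
    (Fin.cons b y : Fin (k + 1) → M) ∈ U.ballk c (Fin.cons a x : Fin (k + 1) → M) ↔
      (a, b) ∈ U.ent c ∧ y ∈ U.ballk c x := by
  simp [ballk, Fin.forall_fin_succ]

/-- The set `A ⊆ M^k` has nonempty interior. -/
def HasInterior (A : Set (Fin k → M)) : Prop :=
  ∃ c ∈ U.dom, ∃ x, U.ballk c x ⊆ A

variable {U} in
theorem HasInterior.mono {A B : Set (Fin k → M)} (hA : U.HasInterior A) (h : A ⊆ B) :
    U.HasInterior B := by
  obtain ⟨c, hc, x, hx⟩ := hA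
  exact ⟨c, hc, x, hx.trans h⟩

/-- A family indexed by the entourages which increases as the entourage shrinks. -/
def Increasing {X : Type*} (A : (Fin U.n → M) → X → Prop) : Prop :=
  ∀ c ∈ U.dom, ∀ e ∈ U.dom, U.ent e ⊆ U.ent c → ∀ x, A c x → A e x

variable {U} in
theorem Increasing.exists_forall_mem {X : Type*} {A : (Fin U.n → M) → X → Prop}
    (hA : U.Increasing A) (T : Finset X) (hT : ∀ x ∈ T, ∃ c ∈ U.dom, A c x) :
    ∃ c ∈ U.dom, ∀ x ∈ T, A c x := by
  induction T using Finset.cons_induction with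
  | empty =>
    obtain ⟨c, hc⟩ := U.dom_nonempty
    exact ⟨c, hc, by simp⟩
  | cons a T ha ih =>
    obtain ⟨c, hc, hcT⟩ := ih fun x hx => hT x (Finset.mem_cons_of_mem hx)
    obtain ⟨d, hd, hda⟩ := hT a (Finset.mem_cons_self a T)
    obtain ⟨e, he, hec, hed⟩ := U.exists_ent_subset_inter hc hd
    refine ⟨e, he, fun x hx => ?_⟩
    obtain rfl | hx := Finset.mem_cons.1 hx
    · exact hA d hd e he hed x hda
    · exact hA c hc e he hec x (hcT x hx)

open TupleType

variable {X : Type u} [TupleType M X]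

theorem defPred_ent {f g : X → M} {c : X → Fin U.n → M} (hf : TermMap L M f)
    (hg : TermMap L M g) (hc : TermMap L M c) :
    DefPred L M fun p => (f p, g p) ∈ U.ent (c p) := by
  have h : TermMap L M fun p => (Sum.elim ![f p, g p] (c p) : Fin 2 ⊕ Fin U.n → M) := by
    refine TermMap.pi ?_
    rintro (j | j)
    · fin_cases j
      · exact hf
      · exact hg
    · exact hc.apply j
  exact (defPred_of_defSet U.phi_def).comp h

theorem defPred_mem_dom {c : X → Fin U.n → M} (hc : TermMap L M c) :
    DefPred L M fun p => c p ∈ U.dom :=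
  (defPred_of_defSet U.dom_def).comp hc

theorem defPred_mem_ballk {f g : X → Fin k → M} {c : X → Fin U.n → M} (hf : TermMap L M f)
    (hg : TermMap L M g) (hc : TermMap L M c) :
    DefPred L M fun p => f p ∈ U.ballk (c p) (g p) :=
  DefPred.forall_finite fun i => U.defPred_ent (hg.apply i) (hf.apply i) hc

end DefUniformBasis

namespace Setting

open DefUniformBasis

variable (S : Setting L M)

theorem countablySaturated (S : Setting L M) : CountablySaturated L M M :=
  countablySaturated_self S.saturated

theorem infinite_ball {c : Fin S.n → M} (hc : c ∈ S.dom) (x : M) :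
    (S.toDefUniformBasis.ball c x).Infinite := by
  intro hfin
  have h (T : Finset M) : ∃ e ∈ S.dom, S.ent e ⊆ S.ent c ∧ ∀ y ∈ T, y ≠ x → (x, y) ∉ S.ent e := by
    induction T using Finset.cons_induction with
    | empty => exact ⟨c, hc, subset_rfl, by simp⟩
    | cons a T ha ih =>
      obtain ⟨e, he, hec, heT⟩ := ih
      by_cases hax : a = x
      · refine ⟨e, he, hec, fun y hy hyx => ?_⟩
        obtain rfl | hy := Finset.mem_cons.1 hy
        · exact absurd hax hyx
        · exact heT y hy hyx
      · have := mt (S.inter_eq_diag x a).1 (Ne.symm hax)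
        push Not at this
        obtain ⟨d, hd, hxa⟩ := this
        obtain ⟨e', he', h1, h2⟩ := S.exists_ent_subset_inter he hd
        refine ⟨e', he', h1.trans hec, fun y hy hyx h => ?_⟩
        obtain rfl | hy := Finset.mem_cons.1 hy
        · exact hxa (h2 h)
        · exact heT y hy hyx (h1 h)
  obtain ⟨e, he, hec, heT⟩ := h hfin.toFinset
  obtain ⟨y, hyx, hy⟩ := S.noIsolated x e he
  exact heT y (hfin.mem_toFinset.2 (hec hy)) hyx hy

theorem exists_ball_subset {A : M → Prop} (hA : DefPred L M A) (hinf : {x | A x}.Infinite) :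
    ∃ x, ∃ c ∈ S.dom, S.toDefUniformBasis.ball c x ⊆ {x | A x} :=
  S.infInterior _ (hA.comp (TermMap.id.apply (0 : Fin 1))).defSet hinf

theorem exists_infinite_of_increasing {A : (Fin S.n → M) → M → Prop}
    (hA : DefPred L M fun p : (Fin S.n → M) × M => A p.1 p.2) (hmono : S.Increasing A)
    (hinf : {y | ∃ c ∈ S.dom, A c y}.Infinite) : ∃ c ∈ S.dom, {y | A c y}.Infinite := by
  by_contra! hfin
  obtain ⟨N, hN⟩ := (S.countablySaturated.pi S.n).exists_ncard_le
    (G := fun c y => c ∈ S.dom ∧ A c y)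
    ((S.defPred_mem_dom TermMap.id.fst).and hA) (fun c => by
      by_cases hc : c ∈ S.dom
      · simpa [hc] using! hfin c hc
      · simp [hc])
  obtain ⟨T, hT, hcard⟩ := hinf.exists_subset_card_eq (N + 1)
  obtain ⟨c, hc, hcT⟩ := hmono.exists_forall_mem T hT
  have h1 := hN c
  have h2 : (T : Set M).ncard ≤ {y | c ∈ S.dom ∧ A c y}.ncard := by
    refine Set.ncard_le_ncard (fun y hy => ⟨hc, hcT y hy⟩) ?_
    simpa [hc] using! hfin c hc
  rw [Set.ncard_coe_finset] at h2
  omega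

theorem finite_slice_of_not_hasInterior {k : ℕ} {D : (Fin (k + 1) → M) → Prop}
    (hD : DefPred L M D) (hInt : ¬ S.HasInterior {z | D z}) (x : Fin k → M) :
    {y | ∃ e ∈ S.dom, ∀ x' ∈ S.ballk e x, D (Fin.cons y x')}.Finite := by
  by_contra hinf
  obtain ⟨e, he, hinf'⟩ := S.exists_infinite_of_increasing
    (A := fun e y => ∀ x', x' ∈ S.ballk e x → D (Fin.cons y x'))
    (DefPred.forall
      ((S.defPred_mem_ballk TermMap.id.snd (TermMap.const x) TermMap.id.fst.fst).imp
        (hD.comp (TermMap.id.fst.snd.cons TermMap.id.snd))))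
    (fun c _ e _ hec y hy x' hx' => hy x' (S.ballk_mono hec x hx')) hinf
  obtain ⟨y, c, hc, hy⟩ := S.exists_ball_subset (DefPred.forall
      ((S.defPred_mem_ballk TermMap.id.snd (TermMap.const x) (TermMap.const e)).imp
        (hD.comp (TermMap.id.fst.cons TermMap.id.snd)))) hinf'
  obtain ⟨d, hd, hdc, hde⟩ := S.exists_ent_subset_inter hc he
  refine hInt ⟨d, hd, Fin.cons y x, fun z hz => ?_⟩
  rw [← Fin.cons_self_tail z] at hz ⊢
  obtain ⟨h1, h2⟩ := S.cons_mem_ballk.1 hz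
  exact hy (hdc h1) _ (S.ballk_mono hde x h2)

/-- If the union of two increasing definable families has interior, then so does some member of
one of the families. -/
theorem exists_hasInterior_of_union {k : ℕ} {D : Bool → (Fin S.n → M) → (Fin k → M) → Prop}
    (hD : ∀ b, DefPred L M fun p : (Fin S.n → M) × (Fin k → M) => D b p.1 p.2)
    (hmono : ∀ b, S.Increasing (D b))
    (hInt : S.HasInterior {x | ∃ b, ∃ c ∈ S.dom, D b c x}) :
    ∃ b, ∃ c ∈ S.dom, S.HasInterior {x | D b c x} := by
  induction k with
  | zero =>
    obtain ⟨c₀, hc₀, x, hx⟩ := hInt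
    obtain ⟨b, c, hc, h⟩ := hx (S.mem_ballk_self hc₀ x)
    exact ⟨b, c, hc, c, hc, x, fun y _ => by rwa [Subsingleton.elim y x]⟩
  | succ k ih =>
    by_contra! hno
    obtain ⟨c₀, hc₀, z, hz⟩ := hInt
    obtain ⟨c₁, hc₁, -, hcomp⟩ := S.exists_ent_comp hc₀
    let F (b : Bool) (c : Fin S.n → M) (x : Fin k → M) (y : M) : Prop :=
      ∃ e, e ∈ S.dom ∧ ∀ x', x' ∈ S.ballk e x → D b c (Fin.cons y x')
    have hF (b : Bool) : DefPred L M
        fun p : ((Fin S.n → M) × (Fin k → M)) × M => p.1.1 ∈ S.dom ∧ F b p.1.1 p.1.2 p.2 :=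
      (S.defPred_mem_dom TermMap.id.fst.fst).and (DefPred.exists
        ((S.defPred_mem_dom TermMap.id.snd).and (DefPred.forall
          ((S.defPred_mem_ballk TermMap.id.snd TermMap.id.fst.fst.fst.snd TermMap.id.fst.snd).imp
            ((hD b).comp (TermMap.id.fst.fst.fst.fst.prodMk
              (TermMap.id.fst.fst.snd.cons TermMap.id.snd)))))))
    have hFfin (b : Bool) (c : Fin S.n → M) (hc : c ∈ S.dom) (x : Fin k → M) :
        {y | F b c x y}.Finite :=
      S.finite_slice_of_not_hasInterior
        ((hD b).comp ((TermMap.const c).prodMk TermMap.id)) (hno b c hc) x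
    have hbound (b : Bool) := ((S.countablySaturated.pi S.n).prod
      (S.countablySaturated.pi k)).exists_ncard_le
        (G := fun p y => p.1 ∈ S.dom ∧ F b p.1 p.2 y) (hF b) (by
          rintro ⟨c, x⟩
          by_cases hc : c ∈ S.dom
          · simpa [hc] using! hFfin b c hc x
          · simp [hc])
    choose N hN using hbound
    have hFmono (b : Bool) (x : Fin k → M) : S.Increasing fun c y => F b c x y := by
      rintro c hc e he hec y ⟨e', he', h⟩
      exact ⟨e', he', fun x' hx' => hmono b c hc e he hec _ (h x' hx')⟩
    have hunion (b : Bool) (x : Fin k → M) (T : Finset M)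
        (hT : ∀ y ∈ T, ∃ c ∈ S.dom, F b c x y) : T.card ≤ N b := by
      obtain ⟨c, hc, hcT⟩ := (hFmono b x).exists_forall_mem T hT
      rw [← Set.ncard_coe_finset]
      have hsub : (T : Set M) ⊆ {y | c ∈ S.dom ∧ F b c x y} := fun y hy => ⟨hc, hcT y hy⟩
      refine (Set.ncard_le_ncard hsub ?_).trans (hN b (c, x))
      simpa [hc] using! hFfin b c hc x
    obtain ⟨T, hT, hcard⟩ :=
      (S.infinite_ball hc₀ (z 0)).exists_subset_card_eq (N false + N true + 1)
    have hdense (T : Finset M) (hT : (T : Set M) ⊆ S.toDefUniformBasis.ball c₀ (z 0)) :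
        ∃ e ∈ S.dom, ∃ x, ∀ x' ∈ S.ballk e x, x' ∈ S.ballk c₀ (Fin.tail z) ∧
          ∀ y ∈ T, ∃ b, ∃ c ∈ S.dom, F b c x' y := by
      induction T using Finset.cons_induction with
      | empty => exact ⟨c₀, hc₀, Fin.tail z, by simp⟩
      | cons y T hy ih' =>
        obtain ⟨e, he, x, hx⟩ := ih' fun a ha => hT (Finset.mem_cons_of_mem ha)
        obtain ⟨b, c, hc, e', he', x', hx'⟩ := ih
          (D := fun b c x' => D b c (Fin.cons y x') ∧ x' ∈ S.ballk e x)
          (fun b => ((hD b).comp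
            (TermMap.id.fst.prodMk ((TermMap.const y).cons TermMap.id.snd))).and
            (S.defPred_mem_ballk TermMap.id.snd (TermMap.const x) (TermMap.const e)))
          (fun b c hc e he hec x => And.imp_left (hmono b c hc e he hec _))
          ⟨e, he, x, fun x' hx' => by
            obtain ⟨b, c, hc, h⟩ := hz (show (Fin.cons y x' : Fin (k + 1) → M) ∈ S.ballk c₀ z by
              rw [← Fin.cons_self_tail z]
              exact S.cons_mem_ballk.2 ⟨hT (Finset.mem_cons_self y T), (hx x' hx').1⟩)
            exact ⟨b, c, hc, h, hx'⟩⟩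
        obtain ⟨d, hd, hde, hdcomp⟩ := S.exists_ent_comp he'
        refine ⟨d, hd, x', fun x'' hx'' => ?_⟩
        obtain ⟨h1, h2⟩ := hx x'' (hx' (S.ballk_mono hde x' hx'')).2
        refine ⟨h1, fun a ha => ?_⟩
        obtain rfl | ha := Finset.mem_cons.1 ha
        · exact ⟨b, c, hc, d, hd, fun w hw => (hx' fun i => hdcomp _ _ _ (hx'' i) (hw i)).1⟩
        · exact h2 a ha
    obtain ⟨e, he, x, hx⟩ := hdense T hT
    have hxT := (hx x (S.mem_ballk_self he x)).2
    classical
    have h1 := hunion false x {y ∈ T | ∃ c ∈ S.dom, F false c x y} (by simp)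
    have h2 := hunion true x {y ∈ T | ∃ c ∈ S.dom, F true c x y} (by simp)
    have h3 : T ⊆ {y ∈ T | ∃ c ∈ S.dom, F false c x y} ∪
        {y ∈ T | ∃ c ∈ S.dom, F true c x y} := by
      intro y hy
      obtain ⟨b, h⟩ := hxT y hy
      cases b
      · exact Finset.mem_union_left _ (Finset.mem_filter.2 ⟨hy, h⟩)
      · exact Finset.mem_union_right _ (Finset.mem_filter.2 ⟨hy, h⟩)
    have h4 := (Finset.card_le_card h3).trans (Finset.card_union_le _ _)
    omega

/-- If the union of two definable sets has interior, then so does one of them. -/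
theorem hasInterior_or {k : ℕ} {P Q : (Fin k → M) → Prop} (hP : DefPred L M P)
    (hQ : DefPred L M Q) (hInt : S.HasInterior {x | P x ∨ Q x}) :
    S.HasInterior {x | P x} ∨ S.HasInterior {x | Q x} := by
  obtain ⟨c, hc⟩ := S.dom_nonempty
  obtain ⟨b, -, -, h⟩ := S.exists_hasInterior_of_union (D := fun b _ => cond b P Q)
    (by
      rintro (_ | _)
      · exact hQ.comp TermMap.id.snd
      · exact hP.comp TermMap.id.snd)
    (fun b _ _ _ _ _ _ => id)
    (hInt.mono (by
      rintro x (h | h)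
      · exact ⟨true, c, hc, h⟩
      · exact ⟨false, c, hc, h⟩))
  cases b
  · exact Or.inr h
  · exact Or.inl h

/-- If the union of an increasing definable family has interior, then so does some member. -/
theorem exists_hasInterior_of_increasing {k : ℕ} {D : (Fin S.n → M) → (Fin k → M) → Prop}
    (hD : DefPred L M fun p : (Fin S.n → M) × (Fin k → M) => D p.1 p.2) (hmono : S.Increasing D)
    (hInt : S.HasInterior {x | ∃ c ∈ S.dom, D c x}) :
    ∃ c ∈ S.dom, S.HasInterior {x | D c x} := by
  obtain ⟨-, h⟩ := S.exists_hasInterior_of_union (D := fun _ => D) (fun _ => hD)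
    (fun _ => hmono) (hInt.mono fun x h => ⟨true, h⟩)
  exact h

/-- If the members of an increasing definable family have dense union, then inside any ball some
member has interior. -/
theorem exists_hasInterior_of_dense {k : ℕ} {D : (Fin S.n → M) → (Fin k → M) → Prop}
    (hD : DefPred L M fun p : (Fin S.n → M) × (Fin k → M) => D p.1 p.2) (hmono : S.Increasing D)
    (hdense : ∀ e ∈ S.dom, ∀ x, ∃ x' ∈ S.ballk e x, ∃ c ∈ S.dom, D c x')
    {e : Fin S.n → M} (he : e ∈ S.dom) (x : Fin k → M) :
    ∃ c ∈ S.dom, S.HasInterior {x' | x' ∈ S.ballk e x ∧ D c x'} := by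
  have hball : DefPred L M fun x' => x' ∈ S.ballk e x :=
    S.defPred_mem_ballk TermMap.id (TermMap.const x) (TermMap.const e)
  have hU : DefPred L M fun x' => ∃ c, c ∈ S.dom ∧ D c x' := DefPred.exists
    ((S.defPred_mem_dom TermMap.id.snd).and (hD.comp (TermMap.id.snd.prodMk TermMap.id.fst)))
  obtain ⟨d, hd, y, hy⟩ | h := S.hasInterior_or hU.not (hball.and hU)
    ⟨e, he, x, fun x' hx' => (em _).symm.imp id fun h => ⟨hx', h⟩⟩
  · obtain ⟨y', hy', h⟩ := hdense d hd y
    exact absurd h (hy hy')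
  · refine S.exists_hasInterior_of_increasing (D := fun c x' => x' ∈ S.ballk e x ∧ D c x')
      ((hball.comp TermMap.id.snd).and hD)
      (fun c hc d hd hdc x => And.imp_right (hmono c hc d hd hdc x)) (h.mono ?_)
    rintro x' ⟨h1, c, hc, h2⟩
    exact ⟨c, hc, h1, h2⟩

end Setting

namespace DefUniformBasis

variable (U : DefUniformBasis L M) {X : Type*} {l : ℕ}

/-- The values of a correspondence at two points are related by the entourage `c`. -/
def Near (G : X → (Fin l → M) → Prop) (c : Fin U.n → M) (x x' : X) : Prop :=
  (∀ y, G x y → ∃ y', G x' y' ∧ y' ∈ U.ballk c y) ∧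
    ∀ y', G x' y' → ∃ y, G x y ∧ y' ∈ U.ballk c y

variable {U} {G : X → (Fin l → M) → Prop}

theorem Near.mono {c d : Fin U.n → M} (h : U.ent d ⊆ U.ent c) {x x' : X}
    (hx : U.Near G d x x') : U.Near G c x x' := by
  refine ⟨fun y hy => ?_, fun y hy => ?_⟩
  · obtain ⟨z, hz, hz'⟩ := hx.1 y hy
    exact ⟨z, hz, U.ballk_mono h y hz'⟩
  · obtain ⟨z, hz, hz'⟩ := hx.2 y hy
    exact ⟨z, hz, U.ballk_mono h z hz'⟩

theorem Near.refl {c : Fin U.n → M} (hc : c ∈ U.dom) (x : X) : U.Near G c x x :=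
  ⟨fun y hy => ⟨y, hy, U.mem_ballk_self hc y⟩, fun y hy => ⟨y, hy, U.mem_ballk_self hc y⟩⟩

theorem Near.trans {c d : Fin U.n → M}
    (hd : ∀ x y z, (x, y) ∈ U.ent d → (y, z) ∈ U.ent d → (x, z) ∈ U.ent c) {x y z : X}
    (hxy : U.Near G d x y) (hyz : U.Near G d y z) : U.Near G c x z := by
  refine ⟨fun a ha => ?_, fun a ha => ?_⟩
  · obtain ⟨b, hb, hab⟩ := hxy.1 a ha
    obtain ⟨b', hb', hbb'⟩ := hyz.1 b hb
    exact ⟨b', hb', fun i => hd _ _ _ (hab i) (hbb' i)⟩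
  · obtain ⟨b, hb, hab⟩ := hyz.2 a ha
    obtain ⟨b', hb', hbb'⟩ := hxy.2 b hb
    exact ⟨b', hb', fun i => hd _ _ _ (hbb' i) (hab i)⟩

open TupleType

variable (U) in
theorem defPred_near {X Y : Type u} [TupleType M X] [TupleType M Y] {G : X → (Fin l → M) → Prop}
    (hG : DefPred L M fun p : X × (Fin l → M) => G p.1 p.2) {f g : Y → X} {c : Y → Fin U.n → M}
    (hf : TermMap L M f) (hg : TermMap L M g) (hc : TermMap L M c) :
    DefPred L M fun p => U.Near G (c p) (f p) (g p) :=
  (DefPred.forall ((hG.comp ((hf.comp TermMap.id.fst).prodMk TermMap.id.snd)).imp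
    (DefPred.exists ((hG.comp ((hg.comp TermMap.id.fst.fst).prodMk TermMap.id.snd)).and
      (U.defPred_mem_ballk TermMap.id.snd TermMap.id.fst.snd (hc.comp TermMap.id.fst.fst)))))).and
  (DefPred.forall ((hG.comp ((hg.comp TermMap.id.fst).prodMk TermMap.id.snd)).imp
    (DefPred.exists ((hG.comp ((hf.comp TermMap.id.fst.fst).prodMk TermMap.id.snd)).and
      (U.defPred_mem_ballk TermMap.id.fst.snd TermMap.id.snd (hc.comp TermMap.id.fst.fst))))))

end DefUniformBasis

namespace Setting

open DefUniformBasis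

variable (S : Setting L M)

theorem exists_infinite_meets_ball {X : M → Prop} {G : M → M → Prop} (hX : DefPred L M X)
    (hG : DefPred L M fun p : M × M => G p.1 p.2) (hinf : {x | X x}.Infinite)
    (hfin : ∀ x, X x → {y | G x y}.Finite) (hne : ∀ x, X x → ∃ y, G x y)
    {d : Fin S.n → M} (hd : d ∈ S.dom) :
    ∃ y, {x | X x ∧ ∃ z, G x z ∧ (y, z) ∈ S.ent d}.Infinite := by
  by_contra! hall
  by_cases hI : {y | ∃ x, X x ∧ G x y}.Finite
  · refine hinf ((hI.biUnion fun y _ => hall y).subset fun x hx => ?_)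
    obtain ⟨y, hy⟩ := hne x hx
    exact Set.mem_biUnion (show ∃ x, X x ∧ G x y from ⟨x, hx, hy⟩)
      ⟨hx, y, hy, S.ent_refl hd y⟩
  · obtain ⟨y, c, hc, hy⟩ := S.exists_ball_subset (DefPred.exists
      ((hX.comp TermMap.id.snd).and (hG.comp (TermMap.id.snd.prodMk TermMap.id.fst)))) hI
    obtain ⟨e, he, hec, hed⟩ := S.exists_ent_subset_inter hc hd
    refine S.infinite_ball he y
      (((hall y).biUnion fun x hx => hfin x hx.1).subset fun z hz => ?_)
    obtain ⟨x, hx, hxz⟩ := hy (hec hz)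
    exact Set.mem_biUnion (show X x ∧ ∃ z, G x z ∧ (y, z) ∈ S.ent d from ⟨hx, z, hxz, hed hz⟩) hxz

theorem exists_infinite_meets_ballk {l : ℕ} {X : M → Prop} {G : M → (Fin l → M) → Prop}
    (hX : DefPred L M X) (hG : DefPred L M fun p : M × (Fin l → M) => G p.1 p.2)
    (hinf : {x | X x}.Infinite) (hfin : ∀ x, X x → {y | G x y}.Finite)
    (hne : ∀ x, X x → ∃ y, G x y) {d : Fin S.n → M} (hd : d ∈ S.dom) :
    ∃ y, {x | X x ∧ ∃ z, G x z ∧ z ∈ S.ballk d y}.Infinite := by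
  induction l generalizing X with
  | zero =>
    refine ⟨Fin.elim0, hinf.mono fun x hx => ?_⟩
    obtain ⟨y, hy⟩ := hne x hx
    exact ⟨hx, y, hy, fun i => i.elim0⟩
  | succ l ih =>
    have hG' : DefPred L M fun p : (M × (Fin l → M)) × M => G p.1.1 (Fin.cons p.2 p.1.2) :=
      hG.comp (TermMap.id.fst.fst.prodMk (TermMap.id.snd.cons TermMap.id.fst.snd))
    have h0 : DefPred L M fun p : M × M => ∃ w, G p.1 (Fin.cons p.2 w) := DefPred.exists
      (hG'.comp ((TermMap.id.fst.fst.prodMk TermMap.id.snd).prodMk TermMap.id.fst.snd))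
    obtain ⟨a, ha⟩ := S.exists_infinite_meets_ball
      (G := fun x b => ∃ w, G x (Fin.cons b w)) hX h0 hinf
      (fun x hx => ((hfin x hx).image fun z => z 0).subset (by
        rintro b ⟨w, hw⟩
        exact ⟨_, hw, rfl⟩))
      (fun x hx => by
        obtain ⟨y, hy⟩ := hne x hx
        exact ⟨y 0, Fin.tail y, by rwa [Fin.cons_self_tail]⟩) hd
    obtain ⟨y, hy⟩ := ih (G := fun x w => ∃ b, G x (Fin.cons b w) ∧ (a, b) ∈ S.ent d)
      (hX.and (DefPred.exists ((h0.comp TermMap.id).and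
        (S.defPred_ent (TermMap.const a) TermMap.id.snd (TermMap.const d)))))
      (DefPred.exists (hG'.and
        (S.defPred_ent (TermMap.const a) TermMap.id.snd (TermMap.const d)))) ha
      (fun x hx => ((hfin x hx.1).image Fin.tail).subset (by
        rintro w ⟨b, hb, -⟩
        exact ⟨_, hb, rfl⟩))
      (by
        rintro x ⟨-, b, ⟨w, hw⟩, hb⟩
        exact ⟨w, b, hw, hb⟩)
    refine ⟨Fin.cons a y, hy.mono ?_⟩
    rintro x ⟨⟨hx, -⟩, w, ⟨b, hb, hab⟩, hw⟩
    exact ⟨hx, _, hb, S.cons_mem_ballk.2 ⟨hab, hw⟩⟩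

theorem exists_infinite_near {l : ℕ} {c : Fin S.n → M} (hc : c ∈ S.dom) (m : ℕ) {X : M → Prop}
    {G : M → (Fin l → M) → Prop} (hX : DefPred L M X)
    (hG : DefPred L M fun p : M × (Fin l → M) => G p.1 p.2) (hinf : {x | X x}.Infinite)
    (hfin : ∀ x, X x → {y | G x y}.Finite) (hm : ∀ x, X x → {y | G x y}.ncard ≤ m) :
    ∃ X' : M → Prop, DefPred L M X' ∧ {x | X' x}.Infinite ∧ (∀ x, X' x → X x) ∧
      ∀ x x', X' x → X' x' → S.Near G c x x' := by
  induction m generalizing X G with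
  | zero =>
    have h (x : M) (hx : X x) (y : Fin l → M) : ¬ G x y := fun hxy =>
      ((Set.ncard_pos (hfin x hx)).2 ⟨y, hxy⟩).not_ge (hm x hx)
    exact ⟨X, hX, hinf, fun _ => id, fun x x' hx hx' =>
      ⟨fun y hy => absurd hy (h x hx y), fun y hy => absurd hy (h x' hx' y)⟩⟩
  | succ m ih =>
    have hE : DefPred L M fun x => ∃ y, G x y := hG.exists
    by_cases hempty : {x | X x ∧ ¬ ∃ y, G x y}.Infinite
    · exact ⟨_, hX.and hE.not, hempty, fun x hx => hx.1, fun x x' hx hx' =>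
        ⟨fun y hy => absurd ⟨y, hy⟩ hx.2, fun y hy => absurd ⟨y, hy⟩ hx'.2⟩⟩
    have hinf' : {x | X x ∧ ∃ y, G x y}.Infinite := by
      refine (hinf.sdiff (Set.not_infinite.1 hempty)).mono fun x hx => ⟨hx.1, ?_⟩
      by_contra h
      exact hx.2 ⟨hx.1, h⟩
    obtain ⟨d, hd, hdc, hcomp⟩ := S.exists_ent_comp hc
    obtain ⟨y, hy⟩ := S.exists_infinite_meets_ballk (hX.and hE) hG hinf'
      (fun x hx => hfin x hx.1) (fun x hx => hx.2) hd
    have hball : DefPred L M fun p : M × (Fin l → M) => p.2 ∈ S.ballk d y :=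
      S.defPred_mem_ballk TermMap.id.snd (TermMap.const y) (TermMap.const d)
    obtain ⟨X', hX', hX'inf, hsub, hnear⟩ := ih
      (G := fun x z => G x z ∧ ¬ z ∈ S.ballk d y) ((hX.and hE).and (hG.and hball).exists)
      (hG.and hball.not) hy
      (fun x hx => (hfin x hx.1.1).subset fun z hz => hz.1)
      (by
        rintro x ⟨⟨hx, -⟩, z, hz, hzy⟩
        have hlt : {z | G x z ∧ ¬ z ∈ S.ballk d y}.ncard < {z | G x z}.ncard := by
          refine Set.ncard_lt_ncard ⟨fun z hz => hz.1, fun h => ?_⟩ (hfin x hx)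
          exact (h hz).2 hzy
        have := hm x hx
        omega)
    refine ⟨X', hX', hX'inf, fun x hx => (hsub x hx).1.1, fun x x' hx hx' => ⟨?_, ?_⟩⟩
    · intro z hz
      by_cases hzy : z ∈ S.ballk d y
      · obtain ⟨-, z', hz', hz'y⟩ := hsub x' hx'
        exact ⟨z', hz', fun i => hcomp _ _ _ (S.ent_symm hd (hzy i)) (hz'y i)⟩
      · obtain ⟨z', hz', h⟩ := (hnear x x' hx hx').1 z ⟨hz, hzy⟩
        exact ⟨z', hz'.1, h⟩
    · intro z hz
      by_cases hzy : z ∈ S.ballk d y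
      · obtain ⟨-, z', hz', hz'y⟩ := hsub x hx
        exact ⟨z', hz', fun i => hcomp _ _ _ (S.ent_symm hd (hz'y i)) (hzy i)⟩
      · obtain ⟨z', hz', h⟩ := (hnear x x' hx hx').2 z ⟨hz, hzy⟩
        exact ⟨z', hz'.1, h⟩

theorem exists_ball_near {l : ℕ} {G : M → (Fin l → M) → Prop}
    (hG : DefPred L M fun p : M × (Fin l → M) => G p.1 p.2) (hfin : ∀ x, {y | G x y}.Finite)
    {c e : Fin S.n → M} (hc : c ∈ S.dom) (he : e ∈ S.dom) (x₀ : M) :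
    ∃ d ∈ S.dom, ∃ x₁, (x₀, x₁) ∈ S.ent e ∧
      ∀ x x', (x₁, x) ∈ S.ent d → (x₁, x') ∈ S.ent d → S.Near G c x x' := by
  obtain ⟨m, hm⟩ := S.countablySaturated.exists_ncard_le hG hfin
  obtain ⟨X', hX', hinf, hsub, hnear⟩ := S.exists_infinite_near hc m
    (S.defPred_ent (TermMap.const x₀) TermMap.id (TermMap.const e)) hG (S.infinite_ball he x₀)
    (fun x _ => hfin x) (fun x _ => hm x)
  obtain ⟨x₁, d, hd, h⟩ := S.exists_ball_subset hX' hinf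
  exact ⟨d, hd, x₁, hsub _ (h (S.ent_refl hd x₁)), fun x x' hx hx' => hnear x x' (h hx) (h hx')⟩

/-- Every correspondence has arbitrarily small oscillation on some ball inside any given ball. -/
theorem exists_ballk_near {k l : ℕ} {G : (Fin k → M) → (Fin l → M) → Prop}
    (hG : DefPred L M fun p : (Fin k → M) × (Fin l → M) => G p.1 p.2)
    (hfin : ∀ x, {y | G x y}.Finite)
    {c e : Fin S.n → M} (hc : c ∈ S.dom) (he : e ∈ S.dom) (x₀ : Fin k → M) :
    ∃ d ∈ S.dom, ∃ x₁, x₁ ∈ S.ballk e x₀ ∧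
      ∀ x x', x ∈ S.ballk d x₁ → x' ∈ S.ballk d x₁ → S.Near G c x x' := by
  induction k generalizing c e with
  | zero =>
    refine ⟨e, he, x₀, S.mem_ballk_self he x₀, fun x x' _ _ => ?_⟩
    rw [Subsingleton.elim x' x]
    exact Near.refl hc x
  | succ k ih =>
    obtain ⟨d, hd, -, hcomp⟩ := S.exists_ent_comp hc
    let A (ε : Fin S.n → M) (z : Fin (k + 1) → M) : Prop :=
      ∀ x, x ∈ S.ballk ε (fun i => z i.succ) → ∀ x', x' ∈ S.ballk ε (fun i => z i.succ) →
        S.Near G d (Fin.cons (z 0) x) (Fin.cons (z 0) x')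
    let B (ε : Fin S.n → M) (z : Fin (k + 1) → M) : Prop :=
      ∀ y, (z 0, y) ∈ S.ent ε → ∀ y', (z 0, y') ∈ S.ent ε →
        S.Near G d (Fin.cons y fun i => z i.succ) (Fin.cons y' fun i => z i.succ)
    have hA : DefPred L M fun p : (Fin S.n → M) × (Fin (k + 1) → M) => A p.1 p.2 :=
      DefPred.forall ((S.defPred_mem_ballk TermMap.id.snd
          (TermMap.pi fun i => TermMap.id.fst.snd.apply i.succ) TermMap.id.fst.fst).imp
        (DefPred.forall ((S.defPred_mem_ballk TermMap.id.snd
          (TermMap.pi fun i => TermMap.id.fst.fst.snd.apply i.succ) TermMap.id.fst.fst.fst).imp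
          (S.defPred_near hG ((TermMap.id.fst.fst.snd.apply 0).cons TermMap.id.fst.snd)
            ((TermMap.id.fst.fst.snd.apply 0).cons TermMap.id.snd) (TermMap.const d)))))
    have hB : DefPred L M fun p : (Fin S.n → M) × (Fin (k + 1) → M) => B p.1 p.2 :=
      DefPred.forall ((S.defPred_ent (TermMap.id.fst.snd.apply 0) TermMap.id.snd
          TermMap.id.fst.fst).imp
        (DefPred.forall ((S.defPred_ent (TermMap.id.fst.fst.snd.apply 0) TermMap.id.snd
          TermMap.id.fst.fst.fst).imp
          (S.defPred_near hG
            (TermMap.id.fst.snd.cons (TermMap.pi fun i => TermMap.id.fst.fst.snd.apply i.succ))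
            (TermMap.id.snd.cons (TermMap.pi fun i => TermMap.id.fst.fst.snd.apply i.succ))
            (TermMap.const d)))))
    obtain ⟨ε, hε, e', he', z', hz'⟩ := S.exists_hasInterior_of_dense hA
      (fun _ _ _ _ h _ hz x hx x' hx' => hz x (S.ballk_mono h _ hx) x' (S.ballk_mono h _ hx'))
      (fun e he z => by
        obtain ⟨d', hd', x₁, hx₁, h⟩ := ih (G := fun x => G (Fin.cons (z 0) x))
          (hG.comp (((TermMap.const (z 0)).cons TermMap.id.fst).prodMk TermMap.id.snd))
          (fun x => hfin _) hd he (Fin.tail z)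
        refine ⟨Fin.cons (z 0) x₁, ?_, d', hd', fun x hx x' hx' => h x x' hx hx'⟩
        rw [← Fin.cons_self_tail z]
        exact S.cons_mem_ballk.2 ⟨S.ent_refl he _, hx₁⟩) he x₀
    obtain ⟨ε', hε', e'', he'', z, hz⟩ := S.exists_hasInterior_of_dense hB
      (fun _ _ _ _ h _ hz y hy y' hy' => hz y (h hy) y' (h hy'))
      (fun e he z => by
        obtain ⟨d', hd', y, hy, h⟩ := S.exists_ball_near
          (G := fun y => G (Fin.cons y (Fin.tail z)))
          (hG.comp ((TermMap.id.fst.cons (TermMap.const _)).prodMk TermMap.id.snd))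
          (fun x => hfin _) hd he (z 0)
        refine ⟨Fin.cons y (Fin.tail z), ?_, d', hd', fun x hx x' hx' => h x x' hx hx'⟩
        exact Fin.cases hy fun i => S.ent_refl he _) he' z'
    obtain ⟨δ, hδ, hδe, hδε⟩ := S.exists_ent_subset_inter he'' hε
    obtain ⟨δ', hδ', hδδ, hδε'⟩ := S.exists_ent_subset_inter hδ hε'
    refine ⟨δ', hδ', z, (hz' (hz (S.mem_ballk_self he'' z)).1).1, fun x x' hx hx' => ?_⟩
    have hx₁ : (Fin.cons (x 0) (Fin.tail z) : Fin (k + 1) → M) ∈ S.ballk e'' z :=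
      Fin.cases (hδe (hδδ (hx 0))) fun i => S.ent_refl he'' _
    have hx₂ : (Fin.cons (z 0) (Fin.tail x') : Fin (k + 1) → M) ∈ S.ballk e'' z :=
      Fin.cases (S.ent_refl he'' _) fun i => hδe (hδδ (hx' i.succ))
    have h1 := (hz' (hz hx₁).1).2 (Fin.tail x) (fun i => hδε (hδδ (hx i.succ)))
      (Fin.tail x') (fun i => hδε (hδδ (hx' i.succ)))
    have h2 := (hz hx₂).2 (x 0) (hδε' (hx 0)) (x' 0) (hδε' (hx' 0))
    have h3 := Near.trans hcomp h1 h2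
    change S.Near G c (Fin.cons (x 0) (Fin.tail x)) (Fin.cons (x' 0) (Fin.tail x')) at h3
    rwa [Fin.cons_self_tail, Fin.cons_self_tail] at h3

end Setting

namespace DefUniformBasis

variable (U : DefUniformBasis L M) {k : ℕ}

theorem le_of_mem_topDim {A : Set (Fin k → M)} {m : ℕ}
    (h : ∃ σ : Fin m → Fin k, Function.Injective σ ∧
      (U.interiork ((fun v => v ∘ σ) '' A)).Nonempty) : m ≤ k := by
  obtain ⟨σ, hσ, -⟩ := h
  simpa using Fintype.card_le_of_injective σ hσ

theorem topDim_eq_of_hasInterior {A : Set (Fin k → M)} (h : U.HasInterior A) :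
    U.topDim A = k := by
  obtain ⟨c, hc, x, hx⟩ := h
  have hne : A ≠ ∅ := Set.Nonempty.ne_empty ⟨x, hx (U.mem_ballk_self hc x)⟩
  rw [topDim, if_neg hne]
  refine congrArg _ (le_antisymm (csSup_le' fun m hm => U.le_of_mem_topDim hm) ?_)
  refine le_csSup ⟨k, fun m hm => U.le_of_mem_topDim hm⟩ ⟨id, Function.injective_id, x, c, hc, ?_⟩
  simpa using hx

theorem topDim_lt_of_not_hasInterior {A : Set (Fin k → M)} (h : ¬ U.HasInterior A) :
    U.topDim A < k := by
  by_cases hne : A = ∅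
  · rw [topDim, if_pos hne]
    exact WithBot.bot_lt_coe k
  rw [topDim, if_neg hne]
  have hlt (m : ℕ) (hm : ∃ σ : Fin m → Fin k, Function.Injective σ ∧
      (U.interiork ((fun v => v ∘ σ) '' A)).Nonempty) : m < k := by
    refine lt_of_le_of_ne (U.le_of_mem_topDim hm) ?_
    rintro rfl
    obtain ⟨σ, hσ, x, c, hc, hx⟩ := hm
    let τ := Equiv.ofBijective σ (Finite.injective_iff_bijective.1 hσ)
    refine h ⟨c, hc, x ∘ τ.symm, fun y hy => ?_⟩
    obtain ⟨v, hv, hvy⟩ := hx (show y ∘ σ ∈ U.ballk c x from fun i => by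
      have := hy (τ i)
      rwa [Function.comp_apply, Equiv.symm_apply_apply] at this)
    have hsurj : Function.Surjective σ := τ.surjective
    rwa [← hsurj.injective_comp_right hvy]
  have hk : 0 < k := by
    obtain ⟨x, hx⟩ := Set.nonempty_iff_ne_empty.2 hne
    rcases k.eq_zero_or_pos with rfl | hk
    · obtain ⟨c, hc⟩ := U.dom_nonempty
      exact absurd ⟨c, hc, x, fun y _ => by rwa [Subsingleton.elim y x]⟩ h
    · exact hk
  refine WithBot.coe_lt_coe.2 ?_
  obtain hs | hs := Set.eq_empty_or_nonempty {m : ℕ | ∃ σ : Fin m → Fin k, Function.Injective σ ∧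
      (U.interiork ((fun v => v ∘ σ) '' A)).Nonempty}
  · rw [hs, csSup_empty]
    exact hk
  · exact hlt _ (Nat.sSup_mem hs ⟨k, fun m hm => U.le_of_mem_topDim hm⟩)

end DefUniformBasis

/-- Every correspondence on a definable open set `V ⊆ M^k` is continuous on a
definable open dense subset of `V`, and hence continuous almost everywhere on `V`. -/
theorem statement1 (S : Setting L M) {k l : ℕ} (V : Set (Fin k → M))
    (hVdef : DefSet L M V) (hVopen : S.toDefUniformBasis.IsOpenk V) (hVne : V.Nonempty)
    (G : Set ((Fin k → M) × (Fin l → M))) (hG : IsCorr L M V G) :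
    ∃ W : Set (Fin k → M), W ⊆ V ∧ DefSet L M W ∧ S.toDefUniformBasis.IsOpenk W ∧
      S.toDefUniformBasis.DenseIn W V ∧
      (∀ x ∈ W, S.toDefUniformBasis.CorrContAt V G x) ∧
      S.toDefUniformBasis.topDim (V \ W) < S.toDefUniformBasis.topDim V := by
  let U := S.toDefUniformBasis
  obtain ⟨hGdef, hGV, hGfin⟩ := hG
  let g (x : Fin k → M) (y : Fin l → M) : Prop := (x, y) ∈ G
  have hg : DefPred L M fun p : (Fin k → M) × (Fin l → M) => g p.1 p.2 :=
    (defPred_of_defSet hGdef).comp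
      (f := fun p : (Fin k → M) × (Fin l → M) => (Sum.elim p.1 p.2 : Fin k ⊕ Fin l → M))
      (TermMap.pi (by
        rintro (j | j)
        · exact TermMap.id.fst.apply j
        · exact TermMap.id.snd.apply j))
  have hgfin (x : Fin k → M) : {y | g x y}.Finite := by
    by_cases hx : x ∈ V
    · exact (hGfin x hx).2
    · exact Set.finite_empty.subset fun y hy => hx (hGV _ hy)
  let O (c : Fin S.n → M) (x : Fin k → M) : Prop :=
    ∃ e, e ∈ S.dom ∧ ∀ x', x' ∈ S.ballk e x → ∀ x'', x'' ∈ S.ballk e x → U.Near g c x' x''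
  have hO : DefPred L M fun p : (Fin S.n → M) × (Fin k → M) => O p.1 p.2 :=
    DefPred.exists ((U.defPred_mem_dom TermMap.id.snd).and (DefPred.forall
      ((U.defPred_mem_ballk TermMap.id.snd TermMap.id.fst.fst.snd TermMap.id.fst.snd).imp
        (DefPred.forall ((U.defPred_mem_ballk TermMap.id.snd TermMap.id.fst.fst.fst.snd
          TermMap.id.fst.fst.snd).imp
          (U.defPred_near hg TermMap.id.fst.snd TermMap.id.snd TermMap.id.fst.fst.fst.fst))))))
  let C (x : Fin k → M) : Prop := ∀ c, c ∈ S.dom → O c x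
  have hC : DefPred L M C := DefPred.forall ((U.defPred_mem_dom TermMap.id.snd).imp
    (hO.comp (TermMap.id.snd.prodMk TermMap.id.fst)))
  have hCint (e : Fin S.n → M) (he : e ∈ S.dom) (x : Fin k → M) :
      U.HasInterior {x' | x' ∈ S.ballk e x ∧ C x'} := by
    refine (S.hasInterior_or ((U.defPred_mem_ballk TermMap.id (TermMap.const x)
      (TermMap.const e)).and hC) hC.not ⟨e, he, x, fun x' hx' =>
        (em (C x')).imp (fun h => ⟨hx', h⟩) id⟩).resolve_right fun h => ?_
    obtain ⟨c, hc, d, hd, x₀, hx₀⟩ := S.exists_hasInterior_of_increasing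
      (D := fun c x => ¬ O c x) hO.not
      (fun c hc d hd hdc x => mt fun ⟨e, he, h⟩ =>
        ⟨e, he, fun x' hx' x'' hx'' => (h x' hx' x'' hx'').mono hdc⟩)
      (h.mono fun x hx => by
        by_contra hx'
        exact hx fun c hc => by_contra fun h => hx' ⟨c, hc, h⟩)
    obtain ⟨d', hd', x₁, hx₁, hnear⟩ := S.exists_ballk_near hg hgfin hc hd x₀
    exact hx₀ hx₁ ⟨d', hd', fun x' hx' x'' hx'' => hnear x' x'' hx' hx''⟩
  let W : Set (Fin k → M) := {x | x ∈ V ∧ ∃ e, e ∈ S.dom ∧ ∀ x', x' ∈ S.ballk e x → C x'}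
  have hWdense : U.DenseIn W V := by
    intro x hx c hc
    obtain ⟨c', hc', hV⟩ := hVopen x hx
    obtain ⟨e, he, hec, hec'⟩ := U.exists_ent_subset_inter hc hc'
    obtain ⟨d, hd, x₁, hx₁⟩ := hCint e he x
    have h := (hx₁ (U.mem_ballk_self hd x₁)).1
    exact ⟨x₁, U.ballk_mono hec x h, hV (U.ballk_mono hec' x h), d, hd, fun x' hx' => (hx₁ hx').2⟩
  refine ⟨W, fun x hx => hx.1, ?_, ?_, hWdense, ?_, ?_⟩
  · exact ((defPred_of_defSet hVdef).and (DefPred.exists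
      ((U.defPred_mem_dom TermMap.id.snd).and (DefPred.forall
        ((U.defPred_mem_ballk TermMap.id.snd TermMap.id.fst.fst TermMap.id.fst.snd).imp
          (hC.comp TermMap.id.snd)))))).defSet
  · rintro x ⟨hxV, e, he, h⟩
    obtain ⟨c, hc, hV⟩ := hVopen x hxV
    obtain ⟨d, hd, hde, hcomp⟩ := U.exists_ent_comp he
    obtain ⟨d', hd', hdd, hdc⟩ := U.exists_ent_subset_inter hd hc
    refine ⟨d', hd', fun y hy => ⟨hV (U.ballk_mono hdc x hy), d, hd, fun y' hy' =>
      h y' fun i => hcomp _ _ _ (hdd (hy i)) (hy' i)⟩⟩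
  · rintro x ⟨hxV, e, he, h⟩ c hc
    obtain ⟨d, hd, hd'⟩ := h x (U.mem_ballk_self he x) c hc
    exact ⟨d, hd, fun x' _ hx' => hd' x (U.mem_ballk_self hd x) x' hx'⟩
  · obtain ⟨x, hx⟩ := hVne
    obtain ⟨c, hc, hxc⟩ := hVopen x hx
    rw [U.topDim_eq_of_hasInterior ⟨c, hc, x, hxc⟩]
    refine U.topDim_lt_of_not_hasInterior ?_
    rintro ⟨d, hd, y, hy⟩
    obtain ⟨y', hy', hy'W⟩ := hWdense (hy (U.mem_ballk_self hd y)).1 d hd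
    exact (hy hy').2 hy'W

end DpTame
end

section
/- Let {D_x : x ∈ M^l} be a definable family of subsets of M^k. Then for any d ≤ k, the set of parameters x ∈ M^l for which dim(D_x) = d is definable. -/
namespace DpTame

open FirstOrder Set Cardinal

universe u

variable {L : FirstOrder.Language.{u, u}} {M : Type u} [L.Structure M]

theorem DefSet.setOf_eq {α : Type} (i j : α) : DefSet L M {v : α → M | v i = v j} :=
  ⟨Language.Term.equal (Language.Term.var i) (Language.Term.var j), by
    ext v
    simp [Language.Formula.realize_equal]⟩

theorem DefSet.setOf_forall {α ι : Type} [Finite ι] {P : ι → Set (α → M)}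
    (hP : ∀ i, DefSet L M (P i)) : DefSet L M {v | ∀ i, v ∈ P i} := by
  have h : DefSet L M (⋂ i, P i) := Set.definable_iInter_of_finite hP
  convert h using 1
  ext v
  simp

/-- Having nonempty interior is a definable property of the members of a definable family. -/
theorem DefUniformBasis.defSet_interiork_nonempty (U : DefUniformBasis L M) {α : Type}
    {m : ℕ} {E : Set (α ⊕ Fin m → M)} (hE : DefSet L M E) :
    DefSet L M {x : α → M | (U.interiork {z : Fin m → M | Sum.elim x z ∈ E}).Nonempty} := by
  let pt (i : Fin m) : Fin 2 ⊕ Fin U.n → ((α ⊕ Fin m) ⊕ Fin U.n) ⊕ Fin m :=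
    Sum.elim ![Sum.inl (Sum.inl (Sum.inr i)), Sum.inr i] (fun j => Sum.inl (Sum.inr j))
  have hball : DefSet L M {v : ((α ⊕ Fin m) ⊕ Fin U.n) ⊕ Fin m → M |
      ∀ i, v ∈ {v | v ∘ pt i ∈ U.phi}} :=
    DefSet.setOf_forall fun i => U.phi_def.preimage_comp (pt i)
  have hfib : DefSet L M {v : ((α ⊕ Fin m) ⊕ Fin U.n) ⊕ Fin m → M |
      v ∘ Sum.elim (Sum.inl ∘ Sum.inl ∘ Sum.inl) Sum.inr ∈ E} :=
    hE.preimage_comp _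
  have hdom : DefSet L M {v : (α ⊕ Fin m) ⊕ Fin U.n → M | v ∘ Sum.inr ∈ U.dom} :=
    U.dom_def.preimage_comp Sum.inr
  have h : DefSet L M _ := Set.Definable.exists_of_finite (Set.Definable.exists_of_finite
    (hdom.inter (Set.Definable.forall_of_finite (hball.compl.union hfib))))
  convert h using 1
  ext x
  refine exists_congr fun y => exists_congr fun c => and_congr Iff.rfl ?_
  refine forall_congr' fun z => ?_
  have hpt (i : Fin m) : Sum.elim (Sum.elim (Sum.elim x y) c) z ∘ pt i
      = Sum.elim ![y i, z i] c := by
    ext (j | j)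
    · fin_cases j <;> rfl
    · rfl
  have hz : Sum.elim (Sum.elim (Sum.elim x y) c) z ∘
      Sum.elim (Sum.inl ∘ Sum.inl ∘ Sum.inl) Sum.inr = Sum.elim x z := by
    ext (j | j) <;> rfl
  simp only [Set.mem_union, Set.mem_compl_iff, Set.mem_ofPred_eq, hpt, hz, ← imp_iff_not_or]
  rfl

/-- The coordinate projections of a definable family form a definable family. -/
theorem DefRel.proj {l k m : ℕ} {D : Set ((Fin l → M) × (Fin k → M))} (hD : DefRel L M D)
    (σ : Fin m → Fin k) :
    DefSet L M {v : Fin l ⊕ Fin m → M |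
      v ∘ Sum.inr ∈ (fun w => w ∘ σ) '' {y | (v ∘ Sum.inl, y) ∈ D}} := by
  have hfib : DefSet L M {v : (Fin l ⊕ Fin m) ⊕ Fin k → M |
      (v ∘ Sum.inl ∘ Sum.inl, v ∘ Sum.inr) ∈ D} :=
    Set.Definable.preimage_comp (Sum.elim (Sum.inl ∘ Sum.inl) Sum.inr) hD
  have heq : DefSet L M {v : (Fin l ⊕ Fin m) ⊕ Fin k → M |
      ∀ i, v ∈ {v | v (Sum.inr (σ i)) = v (Sum.inl (Sum.inr i))}} :=
    DefSet.setOf_forall fun i => DefSet.setOf_eq _ _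
  have h : DefSet L M _ := Set.Definable.exists_of_finite (hfib.inter heq)
  convert h using 1
  ext v
  exact exists_congr fun w => and_congr Iff.rfl funext_iff

theorem DefUniformBasis.topDim_eq_coe_iff (U : DefUniformBasis L M) {k : ℕ}
    (A : Set (Fin k → M)) (d : ℕ) :
    U.topDim A = (d : WithBot ℕ) ↔ A.Nonempty ∧
      (∃ σ : Fin d ↪ Fin k, (U.interiork ((fun v => v ∘ σ) '' A)).Nonempty) ∧
      ∀ e : Fin (k + 1), d < e →
        ¬ ∃ σ : Fin e ↪ Fin k, (U.interiork ((fun v => v ∘ σ) '' A)).Nonempty := by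
  rcases A.eq_empty_or_nonempty with rfl | hA
  · simp [topDim]
  set T : Set ℕ := {l : ℕ | ∃ σ : Fin l → Fin k, Function.Injective σ ∧
        (U.interiork ((fun v => v ∘ σ) '' A)).Nonempty}
  have hmem (e : ℕ) : e ∈ T ↔
      ∃ σ : Fin e ↪ Fin k, (U.interiork ((fun v => v ∘ σ) '' A)).Nonempty :=
    ⟨fun ⟨σ, hσ, h⟩ => ⟨⟨σ, hσ⟩, h⟩, fun ⟨σ, h⟩ => ⟨σ, σ.injective, h⟩⟩
  have hle : ∀ e ∈ T, e ≤ k := by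
    rintro e ⟨σ, hσ, -⟩
    simpa using Fintype.card_le_of_injective σ hσ
  have hne : T.Nonempty := by
    obtain ⟨a, ha⟩ := hA
    obtain ⟨c, hc⟩ := U.dom_nonempty
    exact ⟨0, Fin.elim0, fun i => i.elim0, Fin.elim0, c, hc,
      fun z _ => ⟨a, ha, Subsingleton.elim _ _⟩⟩
  have hdim : U.topDim A = ((sSup T : ℕ) : WithBot ℕ) := if_neg hA.ne_empty
  rw [hdim, Nat.cast_inj]
  simp only [← hmem, hA, true_and]
  constructor
  · rintro rfl
    exact ⟨Nat.sSup_mem hne ⟨k, hle⟩, fun e he h => (le_csSup ⟨k, hle⟩ h).not_gt he⟩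
  · rintro ⟨hd, hmax⟩
    refine IsGreatest.csSup_eq ⟨hd, fun e he => not_lt.1 fun hlt => ?_⟩
    exact hmax ⟨e, Nat.lt_succ_of_le (hle e he)⟩ hlt he

/-- For a definable family `{D_x : x ∈ M^l}` of subsets of `M^k` and any `d ≤ k`,
the set of parameters `x` with `dim(D_x) = d` is definable. -/
theorem statement4 (S : Setting L M) {l k : ℕ} (D : Set ((Fin l → M) × (Fin k → M)))
    (hD : DefRel L M D) (d : ℕ) (hd : d ≤ k) :
    DefSet L M {x : Fin l → M |
      S.toDefUniformBasis.topDim {y | (x, y) ∈ D} = (d : WithBot ℕ)} := by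
  set U := S.toDefUniformBasis
  have hint (e : ℕ) : DefSet L M {x : Fin l → M | ∃ σ : Fin e ↪ Fin k,
      (U.interiork ((fun v => v ∘ σ) '' {y | (x, y) ∈ D})).Nonempty} := by
    have h : DefSet L M (⋃ σ : Fin e ↪ Fin k,
        {x | (U.interiork ((fun v => v ∘ σ) '' {y | (x, y) ∈ D})).Nonempty}) :=
      Set.definable_iUnion_of_finite fun σ => U.defSet_interiork_nonempty (hD.proj σ)
    convert h using 1
    ext x
    simp
  have hlarge : DefSet L M {x : Fin l → M | ∀ e : {e : Fin (k + 1) // d < e},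
      x ∈ {x | ∃ σ : Fin e.1 ↪ Fin k,
        (U.interiork ((fun v => v ∘ σ) '' {y | (x, y) ∈ D})).Nonempty}ᶜ} :=
    DefSet.setOf_forall fun e => (hint e.1).compl
  have h : DefSet L M _ :=
    (Set.Definable.exists_of_finite hD).inter ((hint d).inter hlarge)
  convert h using 1
  ext x
  simp only [Set.mem_ofPred_eq, U.topDim_eq_coe_iff]
  refine and_congr Iff.rfl (and_congr Iff.rfl ?_)
  exact ⟨fun h e => h e.1 e.2, fun h e he => h ⟨e, he⟩⟩

end DpTame
end
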